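/- arXiv:1810.03229 — 2 statements merged into one kernel-verified Lean document; each statement's English description precedes it below -/
import Mathlib

section
/- Let A ∈ ℝ^{n×n}, B ∈ ℝ^{n×m}, and let M ∈ ℝ^{(n+m)×(n+m)} be symmetric. Assume the KYP Conditions KYPC(A, M) hold: (1) det(e^{iω}I − A) ≠ 0 for all ω ∈ ℝ; (2) A is Schur stable; (3) the upper-left n×n block of M is positive semidefinite. Then the following are equivalent: (i) for all ω ∈ ℝ, the m×m Hermitian matrix [((e^{iω}I − A)^{-1}B); I_m]* M [((e^{iω}I − A)^{-1}B); I_m] is negative definite, where * denotes conjugate transpose; (ii) there exists a symmetric positive definite matrix P ∈ ℝ^{n×n} such that M + [[AᵀPA − P, AᵀPB],[BᵀPA, BᵀPB]] ≺ 0. -/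
open Matrix ComplexOrder

section
open Module Module.End

lemma iso_eig {E : Type*} [NormedAddCommGroup E] [InnerProductSpace ℂ E] [FiniteDimensional ℂ E]
    (U : E →ₗᵢ[ℂ] E) : ∃ (b : OrthonormalBasis (Fin (finrank ℂ E)) ℂ E) (l : Fin (finrank ℂ E) → ℂ),
      ∀ i, U (b i) = l i • b i := by
  classical
  set T : E →ₗ[ℂ] E := U.toLinearMap with hT
  have hTU : ∀ x, T x = U x := fun _ => rfl
  have hmod : ∀ (μ : ℂ) (v : E), v ∈ eigenspace T μ → v ≠ 0 → ‖μ‖ = 1 := by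
    intro μ v hv hv0
    rw [mem_eigenspace_iff, hTU] at hv
    have := congrArg norm hv
    rw [U.norm_map, norm_smul] at this
    have h0 : ‖v‖ ≠ 0 := by simpa using hv0
    field_simp at this
    exact this.symm
  have hmod' : ∀ μ : ℂ, ‖μ‖ = 1 → (starRingEnd ℂ) μ * μ = 1 := by
    intro μ h
    rw [← Complex.normSq_eq_conj_mul_self, Complex.normSq_eq_norm_sq, h]; simp
  have hof : OrthogonalFamily ℂ (fun μ => eigenspace T μ) fun μ => (eigenspace T μ).subtypeₗᵢ := by
    rintro μ ν hμν ⟨v, hv⟩ ⟨w, hw⟩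
    by_cases hv' : v = 0
    · simp [hv']
    have H := hmod' μ (hmod μ v hv hv')
    rw [mem_eigenspace_iff, hTU] at hv hw
    have h := U.inner_map_map v w
    rw [hv, hw, inner_smul_left, inner_smul_right] at h
    change inner ℂ v w = 0
    by_contra hne
    rw [← mul_assoc] at h
    have h1 : (starRingEnd ℂ) μ * ν = 1 := by
      apply mul_right_cancel₀ hne; rw [h, one_mul]
    apply hμν
    have h3 : (starRingEnd ℂ) μ ≠ 0 := left_ne_zero_of_mul_eq_one H
    exact mul_left_cancel₀ h3 (H.trans h1.symm)
  have hinv0 : ∀ (μ : ℂ) (v : E), v ∈ (eigenspace T μ)ᗮ → T v ∈ (eigenspace T μ)ᗮ := by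
    intro μ v hv w hw
    by_cases hw0 : w = 0
    · simp [hw0]
    have H := hmod' μ (hmod μ w hw hw0)
    have h := hv w hw
    rw [← U.inner_map_map] at h
    rw [mem_eigenspace_iff, hTU] at hw
    rw [hw, inner_smul_left] at h
    exact (mul_eq_zero.mp h).resolve_left (left_ne_zero_of_mul_eq_one H)
  have hinv : ∀ ⦃v : E⦄ (hv : v ∈ (⨆ μ, eigenspace T μ)ᗮ), T v ∈ (⨆ μ, eigenspace T μ)ᗮ := by
    intro v hv
    rw [← Submodule.iInf_orthogonal] at hv ⊢
    exact T.iInf_invariant hinv0 v hv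
  have hbot : (⨆ μ, eigenspace T μ)ᗮ = ⊥ := by
    by_contra hne
    have : Nontrivial ↥((⨆ μ, eigenspace T μ)ᗮ) := Submodule.nontrivial_iff_ne_bot.mpr hne
    obtain ⟨c, hc⟩ := Module.End.exists_eigenvalue (T.restrict hinv)
    apply hc
    refine eigenspace_restrict_eq_bot hinv ?_
    have H₂ : eigenspace T c ⟂ (⨆ μ, eigenspace T μ)ᗮ :=
      (Submodule.isOrtho_orthogonal_right _).mono_left (le_iSup _ _)
    exact H₂.disjoint
  have hbot' : (⨆ μ : Eigenvalues T, eigenspace T μ)ᗮ = ⊥ :=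
    show (⨆ μ : { μ // eigenspace T μ ≠ ⊥ }, eigenspace T μ)ᗮ = ⊥ by
      rw [iSup_ne_bot_subtype, hbot]
  have hof' : OrthogonalFamily ℂ (fun μ : Eigenvalues T => eigenspace T μ) fun μ =>
      (eigenspace T μ).subtypeₗᵢ := hof.comp Subtype.coe_injective
  have hint : DirectSum.IsInternal fun μ : Eigenvalues T => eigenspace T μ :=
    hof'.isInternal_iff.mpr hbot'
  refine ⟨hint.subordinateOrthonormalBasis rfl hof',
    fun i => (hint.subordinateOrthonormalBasisIndex rfl i hof').val, fun i => ?_⟩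
  have := hint.subordinateOrthonormalBasis_subordinate rfl i hof'
  rwa [mem_eigenspace_iff] at this

end

lemma iso_exists {V E : Type*} [AddCommGroup V] [Module ℂ V]
    [NormedAddCommGroup E] [InnerProductSpace ℂ E] [FiniteDimensional ℂ E]
    (f g : V →ₗ[ℂ] E) (h : ∀ x, ‖f x‖ = ‖g x‖) : ∃ U : E →ₗᵢ[ℂ] E, ∀ x, U (g x) = f x := by
  obtain ⟨s, hs⟩ := LinearMap.exists_rightInverse_of_surjective g.rangeRestrict
    (LinearMap.range_rangeRestrict g)
  have hs' : ∀ y : LinearMap.range g, g (s y) = y := fun y => by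
    have := congrArg Subtype.val (LinearMap.congr_fun hs y)
    simpa using this
  let L : LinearMap.range g →ₗᵢ[ℂ] E := ⟨f ∘ₗ s, fun y => by
    simp [h, hs']⟩
  refine ⟨L.extend, fun x => ?_⟩
  have h1 := L.extend_apply ⟨g x, x, rfl⟩
  have h2 : f (s ⟨g x, x, rfl⟩) = f x := by
    rw [← sub_eq_zero, ← map_sub, ← norm_eq_zero, h, map_sub, hs']; simp
  exact h1.trans h2

open scoped Matrix.Norms.Operator in
lemma pow_tendsto {n : ℕ} (A : Matrix (Fin n) (Fin n) ℂ) (h : ∀ z ∈ spectrum ℂ A, ‖z‖ < 1) :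
    Filter.Tendsto (fun k : ℕ => A ^ k) Filter.atTop (nhds 0) := by
  rcases isEmpty_or_nonempty (Fin n) with hn | hn
  · have : ∀ k : ℕ, A ^ k = 0 := fun k => Subsingleton.elim _ _
    simp [this]
  have h1 : spectralRadius ℂ A < 1 := by
    simpa using spectrum.spectralRadius_lt_of_forall_lt A (r := 1) (fun k hk => by exact_mod_cast h k hk)
  obtain ⟨r, hr1, hr2⟩ := ENNReal.lt_iff_exists_nnreal_btwn.mp h1
  have h2 := spectrum.pow_nnnorm_pow_one_div_tendsto_nhds_spectralRadius A
  have h3 := (h2.eventually_lt_const hr1)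
  refine tendsto_zero_iff_norm_tendsto_zero.mpr ?_
  have hr3 : (r:ℝ) < 1 := by exact_mod_cast hr2
  refine squeeze_zero' (g := fun k : ℕ => (r:ℝ)^k) (Filter.Eventually.of_forall fun k => norm_nonneg _) ?_
    (tendsto_pow_atTop_nhds_zero_of_lt_one r.2 hr3)
  filter_upwards [h3, Filter.eventually_gt_atTop 0] with k hk hk0
  have hk1 : (0:ℝ) < k := by exact_mod_cast hk0
  have := ENNReal.rpow_le_rpow hk.le hk1.le
  rw [← ENNReal.rpow_mul, one_div, inv_mul_cancel₀ hk1.ne', ENNReal.rpow_one, ENNReal.rpow_natCast] at this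
  exact_mod_cast this

lemma psd_factor {ι : Type*} [Fintype ι] [DecidableEq ι] {Z : Matrix ι ι ℝ} (h : Z.PosSemidef) :
    ∃ C : Matrix ι ι ℝ, Z = C * Cᵀ := by
  open scoped MatrixOrder in
  open scoped Matrix.Norms.L2Operator in
  obtain ⟨B, hB⟩ := CStarAlgebra.nonneg_iff_eq_star_mul_self.mp h.nonneg
  exact ⟨Bᵀ, by rw [hB, star_eq_conjTranspose, conjTranspose_eq_transpose_of_trivial, transpose_transpose]⟩

lemma K_compact {ι : Type*} [Fintype ι] [DecidableEq ι] :
    IsCompact {Z : Matrix ι ι ℝ | Z.PosSemidef ∧ Z.trace = 1} := by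
  have h : {Z : Matrix ι ι ℝ | Z.PosSemidef ∧ Z.trace = 1} =
      (fun c : EuclideanSpace ℝ (ι × ι) => (Matrix.of fun i j => c (i, j)) *
        (Matrix.of fun i j => c (i, j))ᵀ) '' (Metric.sphere 0 1) := by
    have htr : ∀ c : EuclideanSpace ℝ (ι × ι), ((Matrix.of fun i j => c (i, j)) *
        (Matrix.of fun i j => c (i, j))ᵀ).trace = ‖c‖ ^ 2 := by
      intro c
      rw [EuclideanSpace.norm_sq_eq, Fintype.sum_prod_type]
      simp [Matrix.trace, Matrix.mul_apply, pow_two]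
    ext Z
    constructor
    · rintro ⟨h1, h2⟩
      obtain ⟨C, rfl⟩ := psd_factor h1
      refine ⟨WithLp.toLp 2 fun p => C p.1 p.2, ?_, rfl⟩
      have := htr (WithLp.toLp 2 fun p => C p.1 p.2)
      have h3 : ‖(WithLp.toLp 2 fun p : ι × ι => C p.1 p.2 : EuclideanSpace ℝ (ι × ι))‖ ^ 2 = 1 :=
        this.symm.trans h2
      rw [mem_sphere_zero_iff_norm]
      exact (pow_eq_one_iff_of_nonneg (norm_nonneg _) two_ne_zero).mp h3
    · rintro ⟨c, hc, rfl⟩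
      refine ⟨?_, ?_⟩
      · have := posSemidef_self_mul_conjTranspose (Matrix.of fun i j => c (i, j))
        rwa [conjTranspose_eq_transpose_of_trivial] at this
      · rw [htr]; simp at hc; simp [hc]
  rw [h]
  refine (isCompact_sphere _ _).image ?_
  have : Continuous fun c : EuclideanSpace ℝ (ι × ι) => (Matrix.of fun i j => c (i, j)) :=
    continuous_matrix fun i j => by simp only [Matrix.of_apply]; fun_prop
  exact this.matrix_mul this.matrix_transpose

lemma K_convex {ι : Type*} [Fintype ι] [DecidableEq ι] :
    Convex ℝ {Z : Matrix ι ι ℝ | Z.PosSemidef ∧ Z.trace = 1} := by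
  rintro X ⟨hX, hX1⟩ Y ⟨hY, hY1⟩ a b ha hb hab
  exact ⟨(hX.smul ha).add (hY.smul hb), by simp [hX1, hY1, hab]⟩

lemma sep {X Y : Type*} [AddCommGroup X] [Module ℝ X] [TopologicalSpace X]
    [NormedAddCommGroup Y] [NormedSpace ℝ Y] (K : Set X) (hK : IsCompact K) (hKc : Convex ℝ K)
    (Φ : X →ₗ[ℝ] Y) (φ : X →ₗ[ℝ] ℝ) (hΦ : Continuous Φ) (hφ : Continuous φ)
    (h : ∀ Z ∈ K, Φ Z = 0 → φ Z < 0) :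
    ∃ (g : Y →L[ℝ] ℝ) (c : ℝ), 0 < c ∧ ∀ Z ∈ K, g (Φ Z) + c * φ Z < 0 := by
  have hd : Disjoint ((Φ.prod φ) '' K) (({0} : Set Y) ×ˢ Set.Ici (0:ℝ)) := by
    rw [Set.disjoint_left]
    rintro _ ⟨Z, hZ, rfl⟩ ⟨h1, h2⟩
    exact absurd (h Z hZ h1) (not_lt.mpr h2)
  obtain ⟨f, u, v, h1, h2, h3⟩ := geometric_hahn_banach_compact_closed
    (hKc.linear_image (Φ.prod φ)) (hK.image (hΦ.prodMk hφ))
    ((convex_singleton (0:Y)).prod (convex_Ici (0:ℝ))) (isClosed_singleton.prod isClosed_Ici) hd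
  obtain ⟨R, hR⟩ := (hK.image hφ).bddAbove
  have hf : ∀ y r, f (y, r) = f (y, 0) + f (0, 1) * r := by
    intro y r
    have : ((y, r) : Y × ℝ) = (y, 0) + r • (0, 1) := by simp
    rw [this, map_add, map_smul]; simp [mul_comm]
  have hv : v < 0 := by
    have := h3 (0, 0) ⟨rfl, Set.mem_Ici.mpr le_rfl⟩
    rwa [show ((0, 0) : Y × ℝ) = 0 from rfl, map_zero] at this
  have hu : u < 0 := h2.trans hv
  have hc : 0 ≤ f (0, 1) := by
    by_contra hneg
    push Not at hneg
    have := h3 (0, v / f (0, 1)) ⟨rfl, (div_pos_of_neg_of_neg hv hneg).le⟩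
    rw [hf, mul_div_cancel₀ _ hneg.ne, show ((0, 0) : Y × ℝ) = 0 from rfl, map_zero] at this
    linarith
  have hRpos : 0 < |R| + 1 := by positivity
  refine ⟨f.comp (ContinuousLinearMap.inl ℝ Y ℝ), f (0, 1) + (-u) / (|R| + 1), ?_, ?_⟩
  · have : 0 < (-u) / (|R| + 1) := div_pos (by linarith) hRpos
    linarith
  · intro Z hZ
    have e1 := h1 _ ⟨Z, hZ, rfl⟩
    have e2 : φ Z ≤ R := hR ⟨Z, hZ, rfl⟩
    have e3 : f (Φ Z, φ Z) < u := e1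
    rw [hf] at e3
    have e4 : (-u) / (|R| + 1) * φ Z ≤ -u := by
      rw [div_mul_eq_mul_div, div_le_iff₀ hRpos]
      have : φ Z ≤ |R| + 1 := by linarith [le_abs_self R]
      nlinarith
    change f (Φ Z, 0) + _ < 0
    linarith

lemma sdp {ι κ : Type*} [Fintype ι] [DecidableEq ι] [Fintype κ] [DecidableEq κ]
    (F G : Matrix κ ι ℝ) (M : Matrix ι ι ℝ)
    (H : ∀ μ : ℂ, ‖μ‖ = 1 → ∀ w : ι → ℂ, w ≠ 0 →
      (F.map (algebraMap ℝ ℂ)) *ᵥ w = μ • ((G.map (algebraMap ℝ ℂ)) *ᵥ w) →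
      (star w ⬝ᵥ (M.map (algebraMap ℝ ℂ)) *ᵥ w).re < 0)
    (Z : Matrix ι ι ℝ) (hZ : Z.PosSemidef) (hZ1 : Z.trace = 1)
    (hFG : F * Z * Fᵀ = G * Z * Gᵀ) : (M * Z).trace < 0 := by
  obtain ⟨C, rfl⟩ := psd_factor hZ
  set Fc := F.map (algebraMap ℝ ℂ) with hFc
  set Gc := G.map (algebraMap ℝ ℂ) with hGc
  set Mc := M.map (algebraMap ℝ ℂ) with hMc
  set W := C.map (algebraMap ℝ ℂ) with hW
  have hFGc : (Fc * W) * (Fc * W)ᴴ = (Gc * W) * (Gc * W)ᴴ := by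
    have := congrArg (fun N : Matrix κ κ ℝ => N.map (algebraMap ℝ ℂ)) hFG
    simp only [Matrix.map_mul] at this
    simp only [conjTranspose_mul, hFc, hGc, hW]
    have e1 : ∀ N : Matrix κ ι ℝ, (N.map (algebraMap ℝ ℂ))ᴴ = Nᵀ.map (algebraMap ℝ ℂ) := by
      intro N; ext i j; simp
    have e2 : (C.map (algebraMap ℝ ℂ))ᴴ = Cᵀ.map (algebraMap ℝ ℂ) := by
      ext i j; simp
    rw [e1, e1, e2]
    simpa only [Matrix.mul_assoc] using this
  set f := toEuclideanLin (Fc * W) with hf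
  set g := toEuclideanLin (Gc * W) with hg
  have hnorm : ∀ (N : Matrix κ ι ℂ) (x : EuclideanSpace ℂ κ),
      ‖(toEuclideanLin N).adjoint x‖ ^ 2 = (inner ℂ x (toEuclideanLin (N * Nᴴ) x)).re := by
    intro N x
    have := inner_self_eq_norm_sq_to_K (𝕜 := ℂ) ((toEuclideanLin N).adjoint x)
    rw [LinearMap.adjoint_inner_left, ← toEuclideanLin_conjTranspose_eq_adjoint] at this
    have e : toEuclideanLin N (toEuclideanLin Nᴴ x) = toEuclideanLin (N * Nᴴ) x := by
      simp [toLpLin_apply, mulVec_mulVec]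
    rw [e] at this
    rw [this, ← toEuclideanLin_conjTranspose_eq_adjoint]
    norm_cast
  obtain ⟨U, hU⟩ := iso_exists f.adjoint g.adjoint (by
    intro x
    have h1 := hnorm (Fc * W) x
    have h2 := hnorm (Gc * W) x
    rw [hFGc, ← h2] at h1
    exact (sq_eq_sq₀ (norm_nonneg _) (norm_nonneg _)).mp h1)
  obtain ⟨b, l, hb⟩ := iso_eig U
  have hl : ∀ i, ‖l i‖ = 1 := by
    intro i
    have := congrArg norm (hb i)
    rw [U.norm_map, norm_smul] at this
    simpa using this.symm
  have hl' : ∀ i, (starRingEnd ℂ) (l i) * l i = 1 := by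
    intro i
    rw [← Complex.normSq_eq_conj_mul_self, Complex.normSq_eq_norm_sq, hl i]; simp
  have hfg : ∀ i, f (b i) = (starRingEnd ℂ) (l i) • g (b i) := by
    intro i
    have h1 : l i • f (b i) = g (b i) := by
      refine ext_inner_right ℂ fun y => ?_
      rw [inner_smul_left, ← LinearMap.adjoint_inner_right, ← LinearMap.adjoint_inner_right,
        ← hU, ← inner_smul_left, ← hb, U.inner_map_map]
    rw [← h1, smul_smul, hl', one_smul]
  let w : Fin (Module.finrank ℂ (EuclideanSpace ℂ ι)) → ι → ℂ := fun i => W *ᵥ (b i).ofLp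
  have hw : ∀ i, w i ≠ 0 → (star (w i) ⬝ᵥ Mc *ᵥ (w i)).re < 0 := by
    intro i hi
    refine H ((starRingEnd ℂ) (l i)) (by simpa using hl i) _ hi ?_
    have := congrArg WithLp.ofLp (hfg i)
    simpa [hf, hg, toLpLin_apply, ← mulVec_mulVec] using this
  have htr : (((M * (C * Cᵀ)).trace : ℝ) : ℂ) = ∑ i, star (w i) ⬝ᵥ Mc *ᵥ (w i) := by
    have h1 := LinearMap.trace_eq_sum_inner (toEuclideanLin (Wᴴ * Mc * W)) b
    have h2 : LinearMap.trace ℂ _ (toEuclideanLin (Wᴴ * Mc * W)) = (Wᴴ * Mc * W).trace := by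
      rw [toEuclideanLin_eq_toLin_orthonormal, Matrix.trace_toLin_eq]
    have h3 : (Wᴴ * Mc * W).trace = (((M * (C * Cᵀ)).trace : ℝ) : ℂ) := by
      have e2 : Wᴴ = Cᵀ.map (algebraMap ℝ ℂ) := by
        ext i j; simp [hW]
      rw [Matrix.mul_assoc, Matrix.trace_mul_comm, e2, hW, hMc, ← Matrix.map_mul, ← Matrix.map_mul,
        ← Matrix.mul_assoc]
      simp [Matrix.trace]
    rw [← h3, ← h2, h1]
    refine Finset.sum_congr rfl fun i _ => ?_
    simp only [w]
    rw [EuclideanSpace.inner_eq_star_dotProduct, dotProduct_comm, star_mulVec, ← dotProduct_mulVec]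
    simp [toLpLin_apply, mulVec_mulVec, Matrix.mul_assoc]
  have htr' : (M * (C * Cᵀ)).trace = ∑ i, (star (w i) ⬝ᵥ Mc *ᵥ (w i)).re := by
    have := congrArg Complex.re htr
    simpa using this
  have hle : ∀ i, (star (w i) ⬝ᵥ Mc *ᵥ (w i)).re ≤ 0 := by
    intro i
    by_cases h0 : w i = 0
    · simp [h0]
    · exact (hw i h0).le
  rw [htr']
  by_cases hall : ∀ i, w i = 0
  · exfalso
    have h1 : toEuclideanLin W = 0 := by
      refine b.toBasis.ext fun i => ?_
      have := hall i
      simp only [w] at this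
      simp [toLpLin_apply, this]
    have h2 : W = 0 := by simpa using h1
    have h3 : C = 0 := by
      ext i j
      have := congrFun (congrFun h2 i) j
      simpa [hW] using this
    simp [h3] at hZ1
  · push Not at hall
    obtain ⟨i, hi⟩ := hall
    exact Finset.sum_neg' (fun i _ => hle i) ⟨i, Finset.mem_univ _, hw i hi⟩

lemma exists_P {ι κ : Type*} [Fintype ι] [DecidableEq ι] [Fintype κ] [DecidableEq κ]
    (F G : Matrix κ ι ℝ) (M : Matrix ι ι ℝ) (hM : M.IsHermitian)
    (H : ∀ μ : ℂ, ‖μ‖ = 1 → ∀ w : ι → ℂ, w ≠ 0 →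
      (F.map (algebraMap ℝ ℂ)) *ᵥ w = μ • ((G.map (algebraMap ℝ ℂ)) *ᵥ w) →
      (star w ⬝ᵥ (M.map (algebraMap ℝ ℂ)) *ᵥ w).re < 0) :
    ∃ P : Matrix κ κ ℝ, P.IsHermitian ∧ (-(M + (Fᵀ * P * F - Gᵀ * P * G))).PosDef := by
  let Φ : Matrix ι ι ℝ →ₗ[ℝ] (κ → κ → ℝ) :=
    { toFun := fun Z => F * Z * Fᵀ - G * Z * Gᵀ
      map_add' := fun X Y => by
        change _ = (F * X * Fᵀ - G * X * Gᵀ) + (F * Y * Fᵀ - G * Y * Gᵀ)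
        simp only [Matrix.mul_add, Matrix.add_mul]; abel
      map_smul' := fun c X => by
        change _ = c • (F * X * Fᵀ - G * X * Gᵀ)
        simp [smul_sub] }
  let φ : Matrix ι ι ℝ →ₗ[ℝ] ℝ :=
    { toFun := fun Z => (M * Z).trace
      map_add' := fun X Y => by simp [Matrix.mul_add]
      map_smul' := fun c X => by simp }
  obtain ⟨g, c, hc, hg⟩ := sep _ K_compact K_convex Φ φ
    (by
      change Continuous fun Z : Matrix ι ι ℝ => F * Z * Fᵀ - G * Z * Gᵀ
      fun_prop)
    (by
      change Continuous fun Z : Matrix ι ι ℝ => (M * Z).trace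
      fun_prop)
    (fun Z hZ h0 => sdp F G M H Z hZ.1 hZ.2 (sub_eq_zero.mp h0))
  let P : Matrix κ κ ℝ := Matrix.of fun i j => g (Pi.single i (Pi.single j 1))
  have hgP : ∀ v : κ → ℝ, g (vecMulVec v v) = v ⬝ᵥ P *ᵥ v := by
    intro v
    have e : (vecMulVec v v : κ → κ → ℝ) = ∑ i, ∑ j, (v i * v j) • Pi.single i (Pi.single j 1) := by
      funext a b
      simp [Finset.sum_apply, vecMulVec_apply, Pi.single_apply, Finset.sum_ite_eq, ite_apply]
    rw [e]
    simp only [map_sum, map_smul, smul_eq_mul]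
    simp only [dotProduct, mulVec, P, Matrix.of_apply, Finset.mul_sum]
    exact Finset.sum_congr rfl fun i _ => Finset.sum_congr rfl fun j _ => by ring
  have hq : ∀ (N : Matrix κ ι ℝ) (z : ι → ℝ), N * vecMulVec z z * Nᵀ = vecMulVec (N *ᵥ z) (N *ᵥ z) := by
    intro N z
    rw [Matrix.mul_vecMulVec, Matrix.vecMulVec_mul, vecMul_transpose]
  have hmain : ∀ z : ι → ℝ, z ≠ 0 → (F *ᵥ z) ⬝ᵥ P *ᵥ (F *ᵥ z) - (G *ᵥ z) ⬝ᵥ P *ᵥ (G *ᵥ z)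
      + c * (z ⬝ᵥ M *ᵥ z) < 0 := by
    intro z hz
    have hpos : 0 < z ⬝ᵥ z := by
      have := dotProduct_star_self_pos_iff.mpr hz
      simpa using this
    have hK := hg ((z ⬝ᵥ z)⁻¹ • vecMulVec z z) ⟨by
      have := posSemidef_vecMulVec_self_star z
      exact this.smul (inv_nonneg.mpr hpos.le), by
      rw [trace_smul, trace_vecMulVec, smul_eq_mul, inv_mul_cancel₀ hpos.ne']⟩
    rw [map_smul, map_smul, map_smul] at hK
    have e1 : g (Φ (vecMulVec z z)) = (F *ᵥ z) ⬝ᵥ P *ᵥ (F *ᵥ z) - (G *ᵥ z) ⬝ᵥ P *ᵥ (G *ᵥ z) := by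
      have : Φ (vecMulVec z z) = (vecMulVec (F *ᵥ z) (F *ᵥ z) : κ → κ → ℝ) - (vecMulVec (G *ᵥ z) (G *ᵥ z) : κ → κ → ℝ) := by
        change F * vecMulVec z z * Fᵀ - G * vecMulVec z z * Gᵀ = _
        rw [hq, hq]
      rw [this]
      exact (g.map_sub _ _).trans (congrArg₂ _ (hgP _) (hgP _))
    have e2 : φ (vecMulVec z z) = z ⬝ᵥ M *ᵥ z := by
      change (M * vecMulVec z z).trace = _
      rw [mul_vecMulVec, trace_vecMulVec, dotProduct_comm]
    rw [e1, e2, smul_eq_mul, smul_eq_mul] at hK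
    have hinv := inv_pos.mpr hpos
    by_contra hcon
    push Not at hcon
    have := mul_nonneg hinv.le hcon
    linarith
  let Q : Matrix κ κ ℝ := (2 * c)⁻¹ • (P + Pᵀ)
  have hQ : Q.IsHermitian := by
    rw [IsHermitian, conjTranspose_eq_transpose_of_trivial]
    simp [Q, add_comm]
  have hQv : ∀ v : κ → ℝ, v ⬝ᵥ Q *ᵥ v = c⁻¹ * (v ⬝ᵥ P *ᵥ v) := by
    intro v
    have : v ⬝ᵥ Pᵀ *ᵥ v = v ⬝ᵥ P *ᵥ v := by
      rw [mulVec_transpose, dotProduct_comm, dotProduct_mulVec]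
    simp only [Q, smul_mulVec, add_mulVec, dotProduct_smul, dotProduct_add, this, smul_eq_mul]
    field_simp; ring
  refine ⟨Q, hQ, ?_⟩
  have hQt : Qᵀ = Q := by simpa [IsHermitian, conjTranspose_eq_transpose_of_trivial] using hQ
  have hMt : Mᵀ = M := by simpa [IsHermitian, conjTranspose_eq_transpose_of_trivial] using hM
  refine PosDef.of_dotProduct_mulVec_pos ?_ ?_
  · rw [IsHermitian, conjTranspose_eq_transpose_of_trivial]
    simp [Matrix.transpose_mul, hQt, hMt, Matrix.mul_assoc]
  · intro z hz
    have h1 := hmain z hz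
    have e : ∀ N : Matrix κ ι ℝ, z ⬝ᵥ (Nᵀ * Q * N) *ᵥ z = c⁻¹ * ((N *ᵥ z) ⬝ᵥ P *ᵥ (N *ᵥ z)) := by
      intro N
      rw [← hQv, Matrix.mul_assoc, ← mulVec_mulVec, ← mulVec_mulVec, dotProduct_mulVec, vecMul_transpose]
    simp only [star_trivial, neg_mulVec, add_mulVec, sub_mulVec, dotProduct_neg, dotProduct_add,
      dotProduct_sub, e]
    have hinv := inv_pos.mpr hc
    have := mul_neg_of_pos_of_neg hinv h1
    have e3 : c⁻¹ * (c * (z ⬝ᵥ M *ᵥ z)) = z ⬝ᵥ M *ᵥ z := by field_simp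
    nlinarith

lemma lyap {n : ℕ} (A P : Matrix (Fin n) (Fin n) ℝ) (hP : P.IsHermitian)
    (hschur : ∀ z ∈ spectrum ℂ (A.map (algebraMap ℝ ℂ)), ‖z‖ < 1)
    (h : ∀ x : Fin n → ℝ, x ≠ 0 → (A *ᵥ x) ⬝ᵥ P *ᵥ (A *ᵥ x) < x ⬝ᵥ P *ᵥ x) : P.PosDef := by
  have h0 := pow_tendsto _ hschur
  have h1 : Filter.Tendsto (fun k : ℕ => A ^ k) Filter.atTop (nhds 0) := by
    have hc : Continuous fun X : Matrix (Fin n) (Fin n) ℂ => X.map Complex.re :=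
      continuous_id.matrix_map Complex.continuous_re
    have := (hc.tendsto 0).comp h0
    have e : ((fun X : Matrix (Fin n) (Fin n) ℂ => X.map Complex.re) ∘
        fun k => (A.map (algebraMap ℝ ℂ)) ^ k) = fun k : ℕ => A ^ k := by
      funext k
      have : (A.map (algebraMap ℝ ℂ)) ^ k = (A ^ k).map (algebraMap ℝ ℂ) :=
        (map_pow (RingHom.mapMatrix (algebraMap ℝ ℂ)) A k).symm
      simp only [Function.comp, this]
      ext i j; simp
    rw [e] at this
    simpa using this
  refine PosDef.of_dotProduct_mulVec_pos hP fun x hx => ?_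
  rw [star_trivial]
  let q : ℕ → ℝ := fun k => (A ^ k *ᵥ x) ⬝ᵥ P *ᵥ (A ^ k *ᵥ x)
  have hq : Filter.Tendsto q Filter.atTop (nhds 0) := by
    have hc : Continuous fun X : Matrix (Fin n) (Fin n) ℝ => (X *ᵥ x) ⬝ᵥ P *ᵥ (X *ᵥ x) := by
      fun_prop
    have := (hc.tendsto 0).comp h1
    simpa [q, Function.comp_def] using this
  have hanti : Antitone q := by
    refine antitone_nat_of_succ_le fun k => ?_
    have e : A ^ (k + 1) *ᵥ x = A *ᵥ (A ^ k *ᵥ x) := by rw [mulVec_mulVec, pow_succ']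
    simp only [q, e]
    by_cases h2 : A ^ k *ᵥ x = 0
    · simp [h2]
    · exact (h _ h2).le
  have h2 : 0 ≤ q 1 := hanti.le_of_tendsto hq 1
  have h3 := h x hx
  simp only [q, pow_one] at h2
  linarith

lemma posDef_map {ι : Type*} [Fintype ι] [DecidableEq ι] {N : Matrix ι ι ℝ} (h : N.PosDef) :
    (N.map (algebraMap ℝ ℂ)).PosDef := by
  obtain ⟨C, hC⟩ := psd_factor h.posSemidef
  have hu := h.isUnit
  have e2 : (C.map (algebraMap ℝ ℂ))ᴴ = Cᵀ.map (algebraMap ℝ ℂ) := by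
    ext i j; simp
  have e : N.map (algebraMap ℝ ℂ) = C.map (algebraMap ℝ ℂ) * (C.map (algebraMap ℝ ℂ))ᴴ := by
    rw [e2, ← Matrix.map_mul, hC]
  have hu2 : IsUnit (N.map (algebraMap ℝ ℂ)) := hu.map (RingHom.mapMatrix (algebraMap ℝ ℂ))
  have hps : (N.map (algebraMap ℝ ℂ)).PosSemidef := by
    rw [e]; exact posSemidef_self_mul_conjTranspose _
  rw [e] at hu2 ⊢
  refine PosDef.mul_conjTranspose_self _ ?_
  refine Matrix.vecMul_injective_of_isUnit ?_
  rw [Matrix.isUnit_iff_isUnit_det] at hu2 ⊢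
  rw [det_mul] at hu2
  exact isUnit_of_mul_isUnit_left hu2

lemma blocks_eq {n m : ℕ} (A P : Matrix (Fin n) (Fin n) ℝ) (B : Matrix (Fin n) (Fin m) ℝ) :
    fromBlocks (Aᵀ * P * A - P) (Aᵀ * P * B) (Bᵀ * P * A) (Bᵀ * P * B) =
    (fromCols A B)ᵀ * P * fromCols A B -
      (fromCols (1 : Matrix (Fin n) (Fin n) ℝ) (0 : Matrix (Fin n) (Fin m) ℝ))ᵀ * P *
       fromCols (1 : Matrix (Fin n) (Fin n) ℝ) (0 : Matrix (Fin n) (Fin m) ℝ) := by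
  simp only [transpose_fromCols, fromRows_mul]
  ext (i | i) (j | j) <;> simp

/-- The KYP lemma under the KYP Conditions: the frequency-domain inequality
holds for all `ω` iff there is a symmetric positive definite `P` solving the strict LMI. -/
theorem kyp_lemma_posdef {n m : ℕ}
    (A : Matrix (Fin n) (Fin n) ℝ) (B : Matrix (Fin n) (Fin m) ℝ)
    (M : Matrix (Fin n ⊕ Fin m) (Fin n ⊕ Fin m) ℝ) (hM : M.IsHermitian)
    (hdet : ∀ ω : ℝ, det (Complex.exp (ω * Complex.I) • (1 : Matrix (Fin n) (Fin n) ℂ) -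
      A.map (algebraMap ℝ ℂ)) ≠ 0)
    (hschur : ∀ z ∈ spectrum ℂ (A.map (algebraMap ℝ ℂ)), ‖z‖ < 1)
    (hM11 : (M.toBlocks₁₁).PosSemidef) :
    (∀ ω : ℝ,
      (-((fromRows ((Complex.exp (ω * Complex.I) • (1 : Matrix (Fin n) (Fin n) ℂ) -
              A.map (algebraMap ℝ ℂ))⁻¹ * B.map (algebraMap ℝ ℂ))
            (1 : Matrix (Fin m) (Fin m) ℂ))ᴴ *
        M.map (algebraMap ℝ ℂ) *
        fromRows ((Complex.exp (ω * Complex.I) • (1 : Matrix (Fin n) (Fin n) ℂ) -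
              A.map (algebraMap ℝ ℂ))⁻¹ * B.map (algebraMap ℝ ℂ))
          (1 : Matrix (Fin m) (Fin m) ℂ))).PosDef)
    ↔ (∃ P : Matrix (Fin n) (Fin n) ℝ, P.IsHermitian ∧ P.PosDef ∧
        (-(M + fromBlocks (Aᵀ * P * A - P) (Aᵀ * P * B) (Bᵀ * P * A)
          (Bᵀ * P * B))).PosDef) := by
  have hmc : ∀ (X : Matrix (Fin n) (Fin n) ℝ) (Y : Matrix (Fin n) (Fin m) ℝ),
      (fromCols X Y).map (algebraMap ℝ ℂ) =
        fromCols (X.map (algebraMap ℝ ℂ)) (Y.map (algebraMap ℝ ℂ)) := by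
    intro X Y; ext i (j | j) <;> simp
  constructor
  · intro hfdi
    obtain ⟨P, hP, hPd⟩ := exists_P (fromCols A B)
      (fromCols (1 : Matrix (Fin n) (Fin n) ℝ) (0 : Matrix (Fin n) (Fin m) ℝ)) M hM (by
      intro μ hμ w hw hFG
      have hμe : Complex.exp ((Complex.arg μ : ℝ) * Complex.I) = μ := by
        have := Complex.norm_mul_exp_arg_mul_I μ
        rwa [hμ, Complex.ofReal_one, one_mul] at this
      have hd := hdet (Complex.arg μ)
      have hf := hfdi (Complex.arg μ)
      rw [hμe] at hd hf
      set R := μ • (1 : Matrix (Fin n) (Fin n) ℂ) - A.map (algebraMap ℝ ℂ) with hR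
      set x := w ∘ Sum.inl with hx
      set u := w ∘ Sum.inr with hu
      have hwe : w = Sum.elim x u := (Sum.elim_comp_inl_inr w).symm
      have hxe : x = (R⁻¹ * B.map (algebraMap ℝ ℂ)) *ᵥ u := by
        rw [hwe, hmc, hmc, fromCols_mulVec_sumElim, fromCols_mulVec_sumElim] at hFG
        have h1 : (B.map (algebraMap ℝ ℂ)) *ᵥ u = R *ᵥ x := by
          rw [hR, sub_mulVec, smul_mulVec, one_mulVec, eq_sub_iff_add_eq, add_comm, hFG]
          simp
        rw [← mulVec_mulVec, h1, mulVec_mulVec, nonsing_inv_mul _ (isUnit_iff_ne_zero.mpr hd),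
          one_mulVec]
      have hwS : w = fromRows (R⁻¹ * B.map (algebraMap ℝ ℂ)) (1 : Matrix (Fin m) (Fin m) ℂ) *ᵥ u := by
        rw [fromRows_mulVec, one_mulVec, ← hxe, ← hwe]
      have hu0 : u ≠ 0 := by
        intro h0
        apply hw
        rw [hwS, h0, mulVec_zero]
      have hpos := hf.re_dotProduct_pos hu0
      rw [neg_mulVec, dotProduct_neg] at hpos
      rw [hwS, star_mulVec, ← dotProduct_mulVec, mulVec_mulVec, mulVec_mulVec]
      rw [map_neg] at hpos
      exact neg_pos.mp hpos)
    rw [← blocks_eq] at hPd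
    refine ⟨P, hP, lyap A P hP hschur ?_, hPd⟩
    intro x hx
    have h1 := hPd.dotProduct_mulVec_pos (x := Sum.elim x 0) (by
      intro h0; apply hx; funext i; simpa using congrFun h0 (Sum.inl i))
    have h2 := hM11.dotProduct_mulVec_nonneg x
    rw [← fromBlocks_toBlocks M, fromBlocks_add] at h1
    rw [star_trivial] at h1 h2
    rw [neg_mulVec, fromBlocks_mulVec, Sum.elim_comp_inl, Sum.elim_comp_inr] at h1
    have e : ∀ (a : Fin n → ℝ) (b : Fin m → ℝ), Sum.elim x (0 : Fin m → ℝ) ⬝ᵥ Sum.elim a b = x ⬝ᵥ a := by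
      intro a b; simp
    rw [dotProduct_neg, e, mulVec_zero, add_zero, add_mulVec, sub_mulVec, dotProduct_add,
      dotProduct_sub, Matrix.mul_assoc, ← mulVec_mulVec, ← mulVec_mulVec,
      dotProduct_mulVec x Aᵀ, vecMul_transpose] at h1
    linarith
  · rintro ⟨P, hP, -, hPd⟩ ω
    have hd := hdet ω
    set μ := Complex.exp (ω * Complex.I) with hμ
    have hμ1 : (starRingEnd ℂ) μ * μ = 1 := by
      rw [← Complex.normSq_eq_conj_mul_self, Complex.normSq_eq_norm_sq, hμ,
        Complex.norm_exp_ofReal_mul_I]; simp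
    set R := μ • (1 : Matrix (Fin n) (Fin n) ℂ) - A.map (algebraMap ℝ ℂ) with hR
    set X := R⁻¹ * B.map (algebraMap ℝ ℂ) with hX
    set S := fromRows X (1 : Matrix (Fin m) (Fin m) ℂ) with hS
    have h1 := (posDef_map hPd).conjTranspose_mul_mul_same (B := S) (by
      intro u v huv
      simp only [hS, fromRows_mulVec, one_mulVec] at huv
      funext i
      simpa using congrFun huv (Sum.inr i))
    rw [blocks_eq] at h1
    have eF : (fromCols A B).map (algebraMap ℝ ℂ) * S = μ • X := by
      have : R * X = B.map (algebraMap ℝ ℂ) := by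
        rw [hX, ← Matrix.mul_assoc, mul_nonsing_inv _ (isUnit_iff_ne_zero.mpr hd), Matrix.one_mul]
      rw [hmc, hS, fromCols_mul_fromRows, Matrix.mul_one, ← this, hR, Matrix.sub_mul,
        Matrix.smul_mul, Matrix.one_mul]
      abel
    have eG : (fromCols (1 : Matrix (Fin n) (Fin n) ℝ) (0 : Matrix (Fin n) (Fin m) ℝ)).map
        (algebraMap ℝ ℂ) * S = X := by
      rw [hmc, hS, fromCols_mul_fromRows]
      simp
    have ht : ∀ N : Matrix (Fin n) (Fin n ⊕ Fin m) ℝ,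
        Sᴴ * (Nᵀ * P * N).map (algebraMap ℝ ℂ) * S =
          (N.map (algebraMap ℝ ℂ) * S)ᴴ * P.map (algebraMap ℝ ℂ) * (N.map (algebraMap ℝ ℂ) * S) := by
      intro N
      have : (N.map (algebraMap ℝ ℂ))ᴴ = Nᵀ.map (algebraMap ℝ ℂ) := by ext i j; simp
      rw [conjTranspose_mul, this, Matrix.map_mul, Matrix.map_mul]
      simp only [Matrix.mul_assoc]
    have hneg : ∀ Y : Matrix (Fin n ⊕ Fin m) (Fin n ⊕ Fin m) ℝ,
        (-Y).map (algebraMap ℝ ℂ) = - Y.map (algebraMap ℝ ℂ) := by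
      intro Y; ext i j; simp
    rw [hneg, Matrix.map_add _ (map_add _), Matrix.map_sub _ (map_sub _), Matrix.mul_neg,
      Matrix.neg_mul, Matrix.mul_add, Matrix.add_mul, Matrix.mul_sub, Matrix.sub_mul, ht, ht,
      eF, eG] at h1
    have e0 : (μ • X)ᴴ * P.map (algebraMap ℝ ℂ) * (μ • X) = Xᴴ * P.map (algebraMap ℝ ℂ) * X := by
      rw [conjTranspose_smul, Matrix.smul_mul, Matrix.smul_mul, Matrix.mul_smul, smul_smul,
        ← starRingEnd_apply, hμ1, one_smul]
    rw [e0, sub_self, add_zero] at h1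
    exact h1
end

section
/- Let μ, λ > 0 with μλ ≤ 1, let β₁, β₂ ∈ [0,1), and let α > 0. For δ ∈ ℝ define A'(δ) = [[1 + β₁ + δ(1 + β₂), −(β₁ + δβ₂)],[1, 0]], B' = [1; 0], C' = [1 + β₂, −β₂], and M'(δ) = [[−(2αδ + λα² + μδ²), −(α + μδ)],[−(α + μδ), −μ]]. Then there exist δ ∈ ℝ satisfying the KYP Conditions KYPC(A'(δ), M'(δ)) and a symmetric positive definite P ∈ ℝ^{2×2} with [[A'ᵀPA' − P, A'ᵀPB'],[B'ᵀPA', B'ᵀPB']] + [[C', 0],[0_{1×2}, 1]]ᵀ M'(δ) [[C', 0],[0_{1×2}, 1]] ≺ 0, if and only if both α < 2(1 + β₁)(1 + √(1 − μλ)) / (λ(1 + 2β₂)) and, for all ω ∈ ℝ, 4(αβ₂ − μβ₁)cos²ω + 2[μ(1 + β₁)² + λα²β₂(1 + β₂) − α(1 + β₁)(1 + 2β₂)]cos ω + 2α(1 + β₁ + 2β₁β₂) − 2μ(1 + β₁²) − λα²[β₂² + (1 + β₂)²] < 0. -/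
open Matrix

/-- The shifted system matrix `A'(δ)` of the general accelerated gradient method. -/
noncomputable def Ashift (β₁ β₂ δ : ℝ) : Matrix (Fin 2) (Fin 2) ℝ :=
  !![1 + β₁ + δ * (1 + β₂), -(β₁ + δ * β₂); 1, 0]

/-- The input matrix `B'` of the shifted representation. -/
noncomputable def Bshift : Matrix (Fin 2) (Fin 1) ℝ := !![1; 0]

/-- The output matrix `C'` of the shifted representation. -/
noncomputable def Cshift (β₂ : ℝ) : Matrix (Fin 1) (Fin 2) ℝ := !![1 + β₂, -β₂]

/-- The shifted multiplier matrix `M'(δ)`, written in `(Fin 1 ⊕ Fin 1)`-block form. -/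
noncomputable def MshiftBlk (μ lam α δ : ℝ) : Matrix (Fin 1 ⊕ Fin 1) (Fin 1 ⊕ Fin 1) ℝ :=
  fromBlocks !![-(2 * α * δ + lam * α ^ 2 + μ * δ ^ 2)] !![-(α + μ * δ)]
    !![-(α + μ * δ)] !![-μ]

/-- Positive trigonometric polynomials of degree two give a positive Gram matrix. -/
theorem gram_exists (r0 r1 r2 : ℝ)
    (h : ∀ c : ℝ, -1 ≤ c → c ≤ 1 → 0 < 2 * r2 * c ^ 2 + r1 * c + (r0 - r2)) :
    ∃ b : ℝ, r2 < b ∧ 0 < b + r2 ∧ r1 ^ 2 < 4 * (b + r2) * (r0 - b) := by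
  have h1 := h 1 (by norm_num) le_rfl
  have h2 := h (-1) le_rfl (by norm_num)
  rcases lt_or_ge (3 * r2) r0 with hc | hc
  · refine ⟨(r0 - r2) / 2, by linarith, by linarith, ?_⟩
    nlinarith
  · have hr2 : 0 < r2 := by nlinarith
    have hv := h (-r1 / (4 * r2)) (by rw [le_div_iff₀ (by positivity)]; linarith)
      (by rw [div_le_iff₀ (by positivity)]; linarith)
    have hD : 0 < 8 * r2 * (r0 - r2) - r1 ^ 2 := by
      have : 8 * r2 * (2 * r2 * (-r1 / (4 * r2)) ^ 2 + r1 * (-r1 / (4 * r2)) + (r0 - r2))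
          = 8 * r2 * (r0 - r2) - r1 ^ 2 := by
        field_simp
        ring
      rw [← this]
      positivity
    set D := 8 * r2 * (r0 - r2) - r1 ^ 2 with hDdef
    set K := 4 * (3 * r2 - r0) + 4 with hK
    have hKpos : 0 < K := by linarith
    obtain ⟨ε, hε, hε1, hεK⟩ : ∃ ε : ℝ, 0 < ε ∧ ε ≤ 1 ∧ ε * K < D := by
      refine ⟨D / (D + K + 1), by positivity, ?_, ?_⟩
      · rw [div_le_one (by positivity)]; linarith
      · rw [div_mul_eq_mul_div, div_lt_iff₀ (by positivity)]; nlinarith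
    refine ⟨r2 + ε, by linarith, by linarith, ?_⟩
    nlinarith

/-- A quadratic form with a persymmetric Gram matrix is positive. -/
theorem gram_pos (r0 r1 r2 b : ℝ) (hb : r2 < b) (hb' : 0 < b + r2)
    (hd : r1 ^ 2 < 4 * (b + r2) * (r0 - b)) (x y z : ℝ) (hne : ¬ (x = 0 ∧ y = 0 ∧ z = 0)) :
    0 < b / 2 * x ^ 2 + (r0 - b) * y ^ 2 + b / 2 * z ^ 2 + r1 / 2 * (x * y + y * z) + r2 * (x * z) := by
  have key : 4 * (b + r2) * (b / 2 * x ^ 2 + (r0 - b) * y ^ 2 + b / 2 * z ^ 2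
        + r1 / 2 * (x * y + y * z) + r2 * (x * z))
      = (b - r2) * (b + r2) * (x - z) ^ 2 + ((b + r2) * (x + z) + r1 * y) ^ 2
        + (4 * (b + r2) * (r0 - b) - r1 ^ 2) * y ^ 2 := by ring
  have hp : 0 < (b - r2) * (b + r2) := mul_pos (by linarith) hb'
  have hq : 0 < 4 * (b + r2) * (r0 - b) - r1 ^ 2 := by linarith
  have : 0 < 4 * (b + r2) * (b / 2 * x ^ 2 + (r0 - b) * y ^ 2 + b / 2 * z ^ 2
        + r1 / 2 * (x * y + y * z) + r2 * (x * z)) := by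
    rw [key]
    by_cases hy : y = 0
    · subst hy
      by_cases hxz : x - z = 0
      · have hx : x = z := by linarith
        subst hx
        have hx0 : x ≠ 0 := fun h => hne ⟨h, rfl, h⟩
        have : 0 < ((b + r2) * (x + x)) ^ 2 := by
          have : (b + r2) * (x + x) ≠ 0 := by
            apply mul_ne_zero hb'.ne'
            intro h; apply hx0; linarith
          positivity
        nlinarith
      · have : 0 < (x - z) ^ 2 := by positivity
        have := mul_pos hp this
        nlinarith [sq_nonneg ((b + r2) * (x + z) + r1 * 0)]
    · have : 0 < y ^ 2 := by positivity
      have := mul_pos hq this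
      have := mul_nonneg hp.le (sq_nonneg (x - z))
      nlinarith [sq_nonneg ((b + r2) * (x + z) + r1 * y)]
  exact pos_of_mul_pos_right this (by linarith)

/-- Discrete Lyapunov theorem for two-dimensional companion matrices. -/
theorem lyap_s6 (t d p11 p12 p22 : ℝ) (hd : d < 1) (h1 : 0 < 1 + d - t) (h2 : 0 < 1 + d + t)
    (hQ : ∀ x y : ℝ, ¬ (x = 0 ∧ y = 0) →
      p11 * (t * x - d * y) ^ 2 + 2 * p12 * (t * x - d * y) * x + p22 * x ^ 2
        < p11 * x ^ 2 + 2 * p12 * x * y + p22 * y ^ 2) :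
    0 < p11 ∧ 0 < p11 * p22 - p12 ^ 2 := by
  obtain ⟨q1, hq1⟩ : ∃ q1, q1 = p11 - t ^ 2 * p11 - 2 * t * p12 - p22 := ⟨_, rfl⟩
  obtain ⟨q2, hq2⟩ : ∃ q2, q2 = p22 - d ^ 2 * p11 := ⟨_, rfl⟩
  obtain ⟨τ, hτ⟩ : ∃ τ, τ = (1 + d) * p12 + d * t * p11 := ⟨_, rfl⟩
  have hform : ∀ x y : ℝ, ¬ (x = 0 ∧ y = 0) → 0 < q1 * x ^ 2 + 2 * τ * x * y + q2 * y ^ 2 := by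
    intro x y hxy
    have := hQ x y hxy
    subst hq1 hq2 hτ
    nlinarith
  have hq1p : 0 < q1 := by simpa using hform 1 0 (by norm_num)
  have hq2p : 0 < q2 := by simpa using hform 0 1 (by norm_num)
  have hdet : 0 < q1 * q2 - τ ^ 2 := by
    have := hform (-τ) q1 (by rintro ⟨-, h⟩; exact hq1p.ne' h)
    have : 0 < q1 * (q1 * q2 - τ ^ 2) := by nlinarith
    exact pos_of_mul_pos_right this hq1p.le
  have hD : 0 < 1 + d := by linarith
  have hDt : 0 < (1 + d) ^ 2 - t ^ 2 := by nlinarith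
  have hN : p11 * ((1 - d) * ((1 + d) ^ 2 - t ^ 2)) = (1 + d) * (q1 + q2) + 2 * t * τ := by
    subst hq1 hq2 hτ; ring
  have e1 := hform 1 1 (by norm_num)
  have e2 := hform 1 (-1) (by norm_num)
  have hNpos : 0 < (1 + d) * (q1 + q2) + 2 * t * τ := by
    have a1 := mul_pos h1 e2
    have a2 := mul_pos h2 e1
    nlinarith
  have hc : 0 < (1 - d) * ((1 + d) ^ 2 - t ^ 2) := mul_pos (by linarith) hDt
  constructor
  · rw [← hN] at hNpos
    exact pos_of_mul_pos_left hNpos hc.le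
  · have key : (p11 * p22 - p12 ^ 2) * (((1 + d) ^ 2 - t ^ 2) * (1 - d) ^ 2)
        = (d * (q1 + q2) + t * τ + (1 - d) * q2) ^ 2 + (1 - d) ^ 2 * (q1 * q2 - τ ^ 2) := by
      subst hq1 hq2 hτ; ring
    have hd2 : 0 < (1 - d) ^ 2 := by
      have : 0 < 1 - d := by linarith
      positivity
    have : 0 < (p11 * p22 - p12 ^ 2) * (((1 + d) ^ 2 - t ^ 2) * (1 - d) ^ 2) := by
      rw [key]
      have := mul_pos hd2 hdet
      nlinarith [sq_nonneg (d * (q1 + q2) + t * τ + (1 - d) * q2)]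
    exact pos_of_mul_pos_left this (mul_pos hDt hd2).le

theorem root_lt (t d : ℝ) (hd : d < 1) (h1 : 0 < 1 + d - t) (h2 : 0 < 1 + d + t) (z : ℂ)
    (hz : z ^ 2 - t * z + d = 0) : ‖z‖ < 1 := by
  have hre := congrArg Complex.re hz
  have him := congrArg Complex.im hz
  simp [pow_two] at hre him
  have hn : ‖z‖ ^ 2 = z.re * z.re + z.im * z.im := by
    rw [← Complex.normSq_eq_norm_sq, Complex.normSq_apply]
  have hlt : z.re * z.re + z.im * z.im < 1 := by
    by_cases hi : z.im = 0
    · rw [hi] at hre ⊢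
      have l1 : z.re < 1 := by
        by_contra hx
        push Not at hx
        nlinarith [mul_nonneg (sub_nonneg.2 hx) (sub_nonneg.2 hx)]
      have l2 : -1 < z.re := by
        by_contra hx
        push Not at hx
        nlinarith
      nlinarith
    · have : t = 2 * z.re := by
        have : z.im * (2 * z.re - t) = 0 := by linarith
        rcases mul_eq_zero.1 this with h | h
        · exact absurd h hi
        · linarith
      subst this
      nlinarith
  rw [← hn] at hlt
  nlinarith [norm_nonneg z]

theorem det_formula (β₁ β₂ δ : ℝ) (z : ℂ) :
    det (z • (1 : Matrix (Fin 2) (Fin 2) ℂ) - (Ashift β₁ β₂ δ).map (algebraMap ℝ ℂ))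
      = z ^ 2 - ((1 + β₁ + δ * (1 + β₂) : ℝ) : ℂ) * z + ((β₁ + δ * β₂ : ℝ) : ℂ) := by
  rw [Matrix.det_fin_two]
  simp [Ashift]
  ring

theorem mem_spec (β₁ β₂ δ : ℝ) (z : ℂ) :
    z ∈ spectrum ℂ ((Ashift β₁ β₂ δ).map (algebraMap ℝ ℂ)) ↔
      z ^ 2 - ((1 + β₁ + δ * (1 + β₂) : ℝ) : ℂ) * z + ((β₁ + δ * β₂ : ℝ) : ℂ) = 0 := by
  rw [← det_formula, spectrum.mem_iff, Matrix.isUnit_iff_isUnit_det, isUnit_iff_ne_zero, not_not,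
    Algebra.algebraMap_eq_smul_one]

/-- The LMI matrix (negated). -/
noncomputable def lmiMat (μ lam β₁ β₂ α δ : ℝ) (P : Matrix (Fin 2) (Fin 2) ℝ) :
    Matrix (Fin 2 ⊕ Fin 1) (Fin 2 ⊕ Fin 1) ℝ :=
  (-(fromBlocks ((Ashift β₁ β₂ δ)ᵀ * P * Ashift β₁ β₂ δ - P)
            ((Ashift β₁ β₂ δ)ᵀ * P * Bshift)
            (Bshiftᵀ * P * Ashift β₁ β₂ δ) (Bshiftᵀ * P * Bshift) +
        (fromBlocks (Cshift β₂) 0 0 (1 : Matrix (Fin 1) (Fin 1) ℝ))ᵀ * MshiftBlk μ lam α δ *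
        (fromBlocks (Cshift β₂) 0 0 (1 : Matrix (Fin 1) (Fin 1) ℝ))))

/-- The quadratic form in terms of the signal values. -/
noncomputable def sform (μ lam β₁ β₂ α p11 p12 p22 s0 s1 s2 : ℝ) : ℝ :=
  μ * (s0 - (1 + β₁) * s1 + β₁ * s2) ^ 2
    + 2 * α * ((1 + β₂) * s1 - β₂ * s2) * (s0 - (1 + β₁) * s1 + β₁ * s2)
    + lam * α ^ 2 * ((1 + β₂) * s1 - β₂ * s2) ^ 2
    - (p11 * s0 ^ 2 + 2 * p12 * s0 * s1 + p22 * s1 ^ 2)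
    + (p11 * s1 ^ 2 + 2 * p12 * s1 * s2 + p22 * s2 ^ 2)

theorem lmi_form (μ lam β₁ β₂ α δ p11 p12 p22 : ℝ) (x : Fin 2 ⊕ Fin 1 → ℝ) :
    star x ⬝ᵥ (lmiMat μ lam β₁ β₂ α δ !![p11, p12; p12, p22] *ᵥ x)
      = sform μ lam β₁ β₂ α p11 p12 p22
        ((1 + β₁ + δ * (1 + β₂)) * x (Sum.inl 0) - (β₁ + δ * β₂) * x (Sum.inl 1) + x (Sum.inr 0))
        (x (Sum.inl 0)) (x (Sum.inl 1)) := by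
  simp [lmiMat, sform, dotProduct, mulVec, Fintype.sum_sum_type, Fin.sum_univ_two, Matrix.mul_apply,
    Ashift, Bshift, Cshift, MshiftBlk, Matrix.transpose_apply, fromBlocks_transpose]
  ring

theorem lmi_herm (μ lam β₁ β₂ α δ p11 p12 p22 : ℝ) :
    (lmiMat μ lam β₁ β₂ α δ !![p11, p12; p12, p22]).IsHermitian := by
  ext i j
  rcases i with i | i <;> rcases j with j | j <;> fin_cases i <;> fin_cases j <;>
  simp [lmiMat, Fintype.sum_sum_type, Fin.sum_univ_two, Matrix.mul_apply,
    Ashift, Bshift, Cshift, MshiftBlk, Matrix.transpose_apply, fromBlocks_transpose] <;>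
  ring

theorem lmi_posDef_iff (μ lam β₁ β₂ α δ p11 p12 p22 : ℝ) :
    (lmiMat μ lam β₁ β₂ α δ !![p11, p12; p12, p22]).PosDef ↔
      ∀ s0 s1 s2 : ℝ, ¬ (s0 = 0 ∧ s1 = 0 ∧ s2 = 0) →
        0 < sform μ lam β₁ β₂ α p11 p12 p22 s0 s1 s2 := by
  constructor
  · intro h s0 s1 s2 hne
    have := h.dotProduct_mulVec_pos
      (x := Sum.elim ![s1, s2] ![s0 - (1 + β₁ + δ * (1 + β₂)) * s1 + (β₁ + δ * β₂) * s2]) ?_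
    · rw [lmi_form] at this
      simp only [Sum.elim_inl, Sum.elim_inr, Matrix.cons_val_zero, Matrix.cons_val_one] at this
      have e : (1 + β₁ + δ * (1 + β₂)) * s1 - (β₁ + δ * β₂) * s2
          + (s0 - (1 + β₁ + δ * (1 + β₂)) * s1 + (β₁ + δ * β₂) * s2) = s0 := by ring
      simpa [e] using this
    · intro h0
      have e1 := congrFun h0 (Sum.inl 0)
      have e2 := congrFun h0 (Sum.inl 1)
      have e3 := congrFun h0 (Sum.inr 0)
      simp at e1 e2 e3
      subst e1 e2
      simp at e3
      exact hne ⟨e3, rfl, rfl⟩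
  · intro h
    refine Matrix.PosDef.of_dotProduct_mulVec_pos (lmi_herm ..) fun x hx => ?_
    rw [lmi_form]
    apply h
    rintro ⟨e0, e1, e2⟩
    apply hx
    rw [e1, e2] at e0
    funext i
    rcases i with i | i <;> fin_cases i
    · exact e1
    · exact e2
    · simpa using e0

theorem posDef_two (p11 p12 p22 : ℝ) (h1 : 0 < p11) (h2 : 0 < p11 * p22 - p12 ^ 2) :
    (!![p11, p12; p12, p22] : Matrix (Fin 2) (Fin 2) ℝ).PosDef := by
  refine Matrix.PosDef.of_dotProduct_mulVec_pos ?_ fun x hx => ?_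
  · ext i j
    fin_cases i <;> fin_cases j <;> simp
  · have e : star x ⬝ᵥ (!![p11, p12; p12, p22] *ᵥ x)
        = p11 * x 0 ^ 2 + 2 * p12 * x 0 * x 1 + p22 * x 1 ^ 2 := by
      simp [dotProduct, mulVec, Fin.sum_univ_two]
      ring
    rw [e]
    have key : p11 * (p11 * x 0 ^ 2 + 2 * p12 * x 0 * x 1 + p22 * x 1 ^ 2)
        = (p11 * x 0 + p12 * x 1) ^ 2 + (p11 * p22 - p12 ^ 2) * x 1 ^ 2 := by ring
    refine pos_of_mul_pos_right (a := p11) ?_ h1.le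
    rw [key]
    by_cases hx1 : x 1 = 0
    · have hx0 : x 0 ≠ 0 := by
        intro hx0
        apply hx
        funext i
        fin_cases i
        · exact hx0
        · exact hx1
      rw [hx1]
      have : 0 < (p11 * x 0) ^ 2 := by positivity
      simpa using this
    · have : 0 < x 1 ^ 2 := by positivity
      have := mul_pos h2 this
      nlinarith [sq_nonneg (p11 * x 0 + p12 * x 1)]

theorem jury_neg (t d : ℝ)
    (h : ∀ z : ℂ, z ^ 2 - (t : ℂ) * z + (d : ℂ) = 0 → ‖z‖ < 1) : 0 < 1 + d + t := by
  by_contra hn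
  push Not at hn
  have hdisc : (t + 2) ^ 2 ≤ t ^ 2 - 4 * d := by nlinarith
  have hnn : 0 ≤ t ^ 2 - 4 * d := le_trans (sq_nonneg _) hdisc
  have hs := Real.sq_sqrt hnn
  have hge : t + 2 ≤ √(t ^ 2 - 4 * d) := Real.le_sqrt_of_sq_le hdisc
  set s := √(t ^ 2 - 4 * d) with hsdef
  have hz := h (((t - s) / 2 : ℝ) : ℂ) (by
    have : ((t - s) / 2) ^ 2 - t * ((t - s) / 2) + d = 0 := by nlinarith
    exact_mod_cast this)
  rw [Complex.norm_real, Real.norm_eq_abs, abs_lt] at hz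
  linarith [hz.1]

theorem step_bound (μ lam α R e : ℝ) (hlam : 0 < lam) (hμlam : μ * lam ≤ 1)
    (he : 0 ≤ e) (heR : e < R) (hq : μ * e ^ 2 - 2 * α * e + lam * α ^ 2 ≤ 0) :
    lam * α < R * (1 + √(1 - μ * lam)) := by
  have hnn : 0 ≤ 1 - μ * lam := by linarith
  have hs := Real.sq_sqrt hnn
  have hs0 := Real.sqrt_nonneg (1 - μ * lam)
  set s := √(1 - μ * lam)
  have h1 : (lam * α - e) ^ 2 ≤ (e * s) ^ 2 := by
    have := mul_nonneg hlam.le (sub_nonneg.2 hq)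
    rw [mul_pow, hs]
    nlinarith
  have h3 := (abs_le_of_sq_le_sq' h1 (by positivity)).2
  nlinarith

/-- Existence of a shifted representation satisfying the KYP Conditions
together with a symmetric positive definite solution of the strict LMI is equivalent to the
step-size bound plus the frequency-domain inequality. -/
theorem lmi_feasible_iff_fdi
    (μ lam β₁ β₂ α : ℝ) (hμ : 0 < μ) (hlam : 0 < lam) (hμlam : μ * lam ≤ 1)
    (hβ₁ : β₁ ∈ Set.Ico (0 : ℝ) 1) (hβ₂ : β₂ ∈ Set.Ico (0 : ℝ) 1) (hα : 0 < α) :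
    (∃ (δ : ℝ) (P : Matrix (Fin 2) (Fin 2) ℝ),
      (∀ ω : ℝ, det (Complex.exp (ω * Complex.I) • (1 : Matrix (Fin 2) (Fin 2) ℂ) -
        (Ashift β₁ β₂ δ).map (algebraMap ℝ ℂ)) ≠ 0) ∧
      (∀ z ∈ spectrum ℂ ((Ashift β₁ β₂ δ).map (algebraMap ℝ ℂ)), ‖z‖ < 1) ∧
      0 ≤ -(2 * α * δ + lam * α ^ 2 + μ * δ ^ 2) ∧
      P.IsHermitian ∧ P.PosDef ∧
      (-(fromBlocks ((Ashift β₁ β₂ δ)ᵀ * P * Ashift β₁ β₂ δ - P)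
            ((Ashift β₁ β₂ δ)ᵀ * P * Bshift)
            (Bshiftᵀ * P * Ashift β₁ β₂ δ) (Bshiftᵀ * P * Bshift) +
        (fromBlocks (Cshift β₂) 0 0 (1 : Matrix (Fin 1) (Fin 1) ℝ))ᵀ * MshiftBlk μ lam α δ *
        (fromBlocks (Cshift β₂) 0 0 (1 : Matrix (Fin 1) (Fin 1) ℝ)))).PosDef)
    ↔ (α < 2 * (1 + β₁) * (1 + Real.sqrt (1 - μ * lam)) / (lam * (1 + 2 * β₂)) ∧
      ∀ ω : ℝ,
        4 * (α * β₂ - μ * β₁) * Real.cos ω ^ 2 +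
          2 * (μ * (1 + β₁) ^ 2 + lam * α ^ 2 * β₂ * (1 + β₂) -
            α * (1 + β₁) * (1 + 2 * β₂)) * Real.cos ω +
          2 * α * (1 + β₁ + 2 * β₁ * β₂) - 2 * μ * (1 + β₁ ^ 2) -
          lam * α ^ 2 * (β₂ ^ 2 + (1 + β₂) ^ 2) < 0) := by
  obtain ⟨hb1, hb1'⟩ := hβ₁
  obtain ⟨hb2, hb2'⟩ := hβ₂
  have hden : 0 < lam * (1 + 2 * β₂) := by positivity
  have hs0 := Real.sqrt_nonneg (1 - μ * lam)
  have hs := Real.sq_sqrt (show 0 ≤ 1 - μ * lam by linarith)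
  constructor
  · rintro ⟨δ, P, -, hspec, hM, hPh, hP, hL⟩
    have hsym : P 1 0 = P 0 1 := by simpa using hPh.apply 0 1
    obtain ⟨p11, p12, p22, rfl⟩ : ∃ p11 p12 p22 : ℝ, P = !![p11, p12; p12, p22] :=
      ⟨P 0 0, P 0 1, P 1 1, by
        ext i j
        fin_cases i <;> fin_cases j <;> simp [hsym]⟩
    have hF := (lmi_posDef_iff μ lam β₁ β₂ α δ p11 p12 p22).1 hL
    constructor
    · have hj := jury_neg _ _ fun z hz => hspec z ((mem_spec β₁ β₂ δ z).2 hz)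
      have hδ : δ ≤ 0 := by
        by_contra hpos
        push Not at hpos
        have : 0 < 2 * α * δ + lam * α ^ 2 + μ * δ ^ 2 := by positivity
        linarith
      have := step_bound μ lam α (2 * (1 + β₁) / (1 + 2 * β₂)) (-δ) hlam hμlam (by linarith)
        (by rw [lt_div_iff₀ (by positivity)]; linarith) (by linarith)
      rw [lt_div_iff₀ hden]
      have h12 : 0 < 1 + 2 * β₂ := by positivity
      rw [div_mul_eq_mul_div, lt_div_iff₀ h12] at this
      linarith
    · intro ω
      have hsc := Real.sin_sq_add_cos_sq ω
      have f1 := hF (Real.cos ω) 1 (Real.cos ω) (by simp)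
      have f2 : 0 ≤ sform μ lam β₁ β₂ α p11 p12 p22 (Real.sin ω) 0 (-Real.sin ω) := by
        by_cases h0 : Real.sin ω = 0
        · simp [h0, sform]
        · exact (hF _ _ _ (fun h => h0 h.1)).le
      have hsum := add_pos_of_pos_of_nonneg f1 f2
      set c := Real.cos ω
      set sn := Real.sin ω
      have hsn : sn ^ 2 = 1 - c ^ 2 := by linarith
      have hid : sform μ lam β₁ β₂ α p11 p12 p22 c 1 c + sform μ lam β₁ β₂ α p11 p12 p22 sn 0 (-sn)
        = -(4 * (α * β₂ - μ * β₁) * c ^ 2 +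
          2 * (μ * (1 + β₁) ^ 2 + lam * α ^ 2 * β₂ * (1 + β₂) -
            α * (1 + β₁) * (1 + 2 * β₂)) * c +
          2 * α * (1 + β₁ + 2 * β₁ * β₂) - 2 * μ * (1 + β₁ ^ 2) -
          lam * α ^ 2 * (β₂ ^ 2 + (1 + β₂) ^ 2)) := by
        unfold sform
        linear_combination (μ * (1 - β₁) ^ 2 + 2 * α * β₂ * (1 - β₁) + lam * α ^ 2 * β₂ ^ 2
          - p11 + p22) * hsn
      linarith
  · rintro ⟨hα', hfdi⟩
    obtain ⟨r2, hr2⟩ : ∃ r2, r2 = 2 * (μ * β₁ - α * β₂) := ⟨_, rfl⟩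
    obtain ⟨r1, hr1⟩ : ∃ r1, r1 = -(2 * (μ * (1 + β₁) ^ 2 + lam * α ^ 2 * β₂ * (1 + β₂) -
            α * (1 + β₁) * (1 + 2 * β₂))) := ⟨_, rfl⟩
    obtain ⟨r0, hr0⟩ : ∃ r0, r0 = r2 - (2 * α * (1 + β₁ + 2 * β₁ * β₂) - 2 * μ * (1 + β₁ ^ 2) -
          lam * α ^ 2 * (β₂ ^ 2 + (1 + β₂) ^ 2)) := ⟨_, rfl⟩
    obtain ⟨b, hb, hb', hbd⟩ := gram_exists r0 r1 r2 (by
      intro c hc hc'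
      have := hfdi (Real.arccos c)
      rw [Real.cos_arccos hc hc'] at this
      rw [hr0, hr1, hr2]
      linarith)
    obtain ⟨p11, hp11⟩ : ∃ p, p = μ - b / 2 := ⟨_, rfl⟩
    obtain ⟨p12, hp12⟩ : ∃ p, p = -μ * (1 + β₁) + α * (1 + β₂) - r1 / 4 := ⟨_, rfl⟩
    obtain ⟨p22, hp22⟩ : ∃ p, p = b / 2 - (μ * β₁ ^ 2 - 2 * α * β₂ * β₁ + lam * α ^ 2 * β₂ ^ 2) :=
      ⟨_, rfl⟩
    have hF : ∀ s0 s1 s2 : ℝ, ¬ (s0 = 0 ∧ s1 = 0 ∧ s2 = 0) →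
        0 < sform μ lam β₁ β₂ α p11 p12 p22 s0 s1 s2 := by
      intro s0 s1 s2 hne
      have := gram_pos r0 r1 r2 b hb hb' hbd s0 s1 s2 hne
      convert this using 1
      rw [hp11, hp12, hp22, hr0, hr1, hr2]
      unfold sform
      ring
    set s := √(1 - μ * lam)
    obtain ⟨δ, hδ⟩ : ∃ δ, δ = -(α * lam / (1 + s)) := ⟨_, rfl⟩
    have hs1 : 0 < 1 + s := by linarith
    have hδneg : δ < 0 := by
      rw [hδ]
      have : 0 < α * lam / (1 + s) := by positivity
      linarith
    have hδs : δ * (1 + s) = -(α * lam) := by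
      rw [hδ]; field_simp
    have hδr : 0 < 2 * (1 + β₁) + δ * (1 + 2 * β₂) := by
      rw [lt_div_iff₀ hden] at hα'
      have : 0 < (2 * (1 + β₁) + δ * (1 + 2 * β₂)) * (1 + s) := by
        have : (2 * (1 + β₁) + δ * (1 + 2 * β₂)) * (1 + s)
          = 2 * (1 + β₁) * (1 + s) + δ * (1 + s) * (1 + 2 * β₂) := by ring
        rw [this, hδs]
        linarith
      exact pos_of_mul_pos_left this hs1.le
    have hM : 2 * α * δ + lam * α ^ 2 + μ * δ ^ 2 = 0 := by
      have : lam * (2 * α * δ + lam * α ^ 2 + μ * δ ^ 2) = 0 := by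
        linear_combination (δ * (1 - s) + α * lam) * hδs + δ ^ 2 * hs
      rcases mul_eq_zero.1 this with h | h
      · exact absurd h hlam.ne'
      · exact h
    have hd : β₁ + δ * β₂ < 1 := by nlinarith
    have h1 : 0 < 1 + (β₁ + δ * β₂) - (1 + β₁ + δ * (1 + β₂)) := by linarith
    have h2 : 0 < 1 + (β₁ + δ * β₂) + (1 + β₁ + δ * (1 + β₂)) := by linarith
    have hroot := root_lt _ _ hd h1 h2
    obtain ⟨hP1, hP2⟩ := lyap_s6 _ _ p11 p12 p22 hd h1 h2 (by
      intro x y hxy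
      have := hF ((1 + β₁ + δ * (1 + β₂)) * x - (β₁ + δ * β₂) * y) x y
        (fun h => hxy ⟨h.2.1, h.2.2⟩)
      have e : sform μ lam β₁ β₂ α p11 p12 p22
          ((1 + β₁ + δ * (1 + β₂)) * x - (β₁ + δ * β₂) * y) x y
          = (2 * α * δ + lam * α ^ 2 + μ * δ ^ 2) * ((1 + β₂) * x - β₂ * y) ^ 2
          - (p11 * ((1 + β₁ + δ * (1 + β₂)) * x - (β₁ + δ * β₂) * y) ^ 2
            + 2 * p12 * ((1 + β₁ + δ * (1 + β₂)) * x - (β₁ + δ * β₂) * y) * x + p22 * x ^ 2)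
          + (p11 * x ^ 2 + 2 * p12 * x * y + p22 * y ^ 2) := by
        unfold sform; ring
      rw [e, hM] at this
      linarith)
    have hPD := posDef_two p11 p12 p22 hP1 hP2
    refine ⟨δ, !![p11, p12; p12, p22], ?_, ?_, by linarith, hPD.1, hPD,
      (lmi_posDef_iff μ lam β₁ β₂ α δ p11 p12 p22).2 hF⟩
    · intro ω h
      rw [det_formula] at h
      have := hroot _ h
      rw [Complex.norm_exp_ofReal_mul_I] at this
      exact lt_irrefl _ this
    · intro z hz
      exact hroot z ((mem_spec β₁ β₂ δ z).1 hz)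
end
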